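/- Let k ≥ 0 be a natural number and let θ and θ' be units of the ring ℤ_2 of 2-adic integers. Then the 2×2 diagonal matrix diag(θ·2^k, θ'·2^(k+2)) is congruent over ℤ_2 to the 2×2 diagonal matrix diag(5θ·2^k, 5θ'·2^(k+2)). -/

import Mathlib

/-- Every 2-adic unit is congruent to `1` modulo `2`. -/
lemma norm_one_sub_unit_lt_one (u : (PadicInt 2)ˣ) : ‖(1 - u : PadicInt 2)‖ < 1 := by
  have hu : PadicInt.toZMod (u : PadicInt 2) = 1 := by
    have h : IsUnit (PadicInt.toZMod (u : PadicInt 2)) := u.isUnit.map _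
    generalize PadicInt.toZMod (u : PadicInt 2) = z at h
    revert z
    decide
  have hker : (1 - u : PadicInt 2) ∈ RingHom.ker (PadicInt.toZMod (p := 2)) := by
    simp [RingHom.mem_ker, hu]
  rw [PadicInt.ker_toZMod, IsLocalRing.mem_maximalIdeal] at hker
  exact PadicInt.mem_nonunits.mp hker

/-- For a 2-adic unit `u`, the element `5 - 4 * u` is a square. -/
lemma exists_sq_eq_five_sub_four_mul_unit (u : (PadicInt 2)ˣ) :
    ∃ x : PadicInt 2, x ^ 2 = 5 - 4 * u := by
  let F : Polynomial (PadicInt 2) :=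
    Polynomial.X ^ 2 + Polynomial.X - Polynomial.C (1 - u : PadicInt 2)
  have hF : ‖F.aeval (0 : PadicInt 2)‖ < ‖F.derivative.aeval (0 : PadicInt 2)‖ ^ 2 := by
    have h := norm_one_sub_unit_lt_one u
    rw [← norm_neg] at h
    simpa [F] using h
  obtain ⟨t, ht, -⟩ := hensels_lemma hF
  have hroot : t ^ 2 + t - (1 - u) = 0 := by simpa [F] using ht
  exact ⟨1 + 2 * t, by linear_combination 4 * hroot⟩

/-- Relation (h):
`K_θ^{(2)}(2^k) ⊕ K_{θ'}^{(2)}(2^{k+2}) ≅ K_{5θ}^{(2)}(2^k) ⊕ K_{5θ'}^{(2)}(2^{k+2})`. -/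
theorem relation_h (k : ℕ) (θ θ' : (PadicInt 2)ˣ) :
    ∃ P : Matrix (Fin 2) (Fin 2) (PadicInt 2), IsUnit P.det ∧
      P.transpose *
          Matrix.diagonal ![(θ : PadicInt 2) * 2 ^ k, (θ' : PadicInt 2) * 2 ^ (k + 2)] * P =
        Matrix.diagonal ![5 * (θ : PadicInt 2) * 2 ^ k,
          5 * (θ' : PadicInt 2) * 2 ^ (k + 2)] := by
  obtain ⟨u, rfl⟩ : ∃ u, θ' = θ * u := ⟨θ⁻¹ * θ', by simp⟩
  obtain ⟨x, hx⟩ := exists_sq_eq_five_sub_four_mul_unit u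
  refine ⟨!![x, -4 * u; 1, x], ?_, ?_⟩
  · have hdet : (!![x, -4 * (u : PadicInt 2); 1, x]).det = ((5 : ℕ) : PadicInt 2) := by
      rw [Matrix.det_fin_two_of]
      push_cast
      linear_combination hx
    rw [hdet, PadicInt.isUnit_iff, PadicInt.norm_natCast_eq_one_iff]
    decide
  · ext i j
    fin_cases i <;> fin_cases j <;>
      simp [Matrix.mul_apply, Fin.sum_univ_two, Matrix.diagonal_apply]
    · linear_combination (θ : PadicInt 2) * 2 ^ k * hx
    · ring
    · ring
    · linear_combination 4 * (θ : PadicInt 2) * u * 2 ^ k * hx
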